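/- In the stated model, with T_k := 2 Σ_{j=2}^{Z_{k−1}} X̃_{k,j} S_{j−1}, where X̃_{k,i} := X_{k,i} − 1 and S_j := Σ_{i=1}^j X̃_{k,i}, one has the conditional second moment identity E(T_k² | ℑ(k−1)) = 2 b⁴ Z_{k−1}(Z_{k−1} − 1) almost surely. -/

import Mathlib

open MeasureTheory ProbabilityTheory Filter Finset

/-- partial sums -/
def auxS {Ω : Type*} (x : ℕ → Ω → ℝ) (N : ℕ) (ω : Ω) : ℝ := ∑ i ∈ Finset.Icc 1 N, x i ω

/-- the quadratic form -/
def auxT {Ω : Type*} (x : ℕ → Ω → ℝ) (N : ℕ) (ω : Ω) : ℝ :=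
  ∑ j ∈ Finset.Icc 2 N, x j ω * ∑ i ∈ Finset.Icc 1 (j - 1), x i ω

lemma auxS_succ {Ω : Type*} (x : ℕ → Ω → ℝ) (N : ℕ) (ω : Ω) :
    auxS x (N + 1) ω = auxS x N ω + x (N + 1) ω := by
  unfold auxS
  rw [Finset.sum_Icc_succ_top (by omega)]

lemma auxT_succ {Ω : Type*} (x : ℕ → Ω → ℝ) (N : ℕ) (ω : Ω) :
    auxT x (N + 1) ω = auxT x N ω + x (N + 1) ω * auxS x N ω := by
  unfold auxT auxS
  rcases Nat.eq_zero_or_pos N with rfl | h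
  · simp
  · rw [Finset.sum_Icc_succ_top (by omega)]; simp

lemma auxS_meas {Ω : Type*} {m : MeasurableSpace Ω} (x : ℕ → Ω → ℝ) (N : ℕ)
    (h : ∀ i, i ≤ N → Measurable (x i)) : Measurable (auxS x N) := by
  unfold auxS
  refine Finset.measurable_fun_sum _ fun i hi => h i (Finset.mem_Icc.1 hi).2

lemma auxT_meas {Ω : Type*} {m : MeasurableSpace Ω} (x : ℕ → Ω → ℝ) (N : ℕ)
    (h : ∀ i, i ≤ N → Measurable (x i)) : Measurable (auxT x N) := by
  unfold auxT
  refine Finset.measurable_fun_sum _ fun j hj => ?_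
  have hj := (Finset.mem_Icc.1 hj).2
  refine (h j hj).mul ?_
  exact auxS_meas x (j - 1) fun i hi => h i (by omega)

lemma meas_iSup {Ω ι β : Type*} [mβ : MeasurableSpace β] (x : ι → Ω → β) (A : Set ι) (i : ι)
    (hi : i ∈ A) : Measurable[⨆ j ∈ A, MeasurableSpace.comap (x j) mβ] (x i) := by
  apply Measurable.of_comap_le
  exact le_biSup (fun j => MeasurableSpace.comap (x j) mβ) hi

lemma indep_of_meas {Ω β γ : Type*} [m0 : MeasurableSpace Ω] {P : Measure Ω}
    [mβ : MeasurableSpace β] [mγ : MeasurableSpace γ] {m1 m2 : MeasurableSpace Ω}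
    (h : Indep m1 m2 P) {f : Ω → β} {g : Ω → γ} (hf : Measurable[m1] f) (hg : Measurable[m2] g) :
    IndepFun f g P := by
  rw [IndepFun_iff_Indep]
  exact indep_of_indep_of_le_left (indep_of_indep_of_le_right h hg.comap_le) hf.comap_le

lemma moments {Ω : Type*} [m0 : MeasurableSpace Ω] (P : Measure Ω) [IsProbabilityMeasure P]
    (x : ℕ → Ω → ℝ) (b2 : ℝ) (hm : ∀ i, Measurable (x i))
    (hind : iIndepFun x P) (h2 : ∀ i, MemLp (x i) 2 P) (h0 : ∀ i, ∫ ω, x i ω ∂P = 0)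
    (hb : ∀ i, ∫ ω, x i ω ^ 2 ∂P = b2) (N : ℕ) :
    MemLp (auxS x N) 2 P ∧ MemLp (auxT x N) 2 P ∧ ∫ ω, auxS x N ω ^ 2 ∂P = N * b2 ∧
      ∫ ω, auxT x N ω ^ 2 ∂P = b2 ^ 2 * N * (N - 1) / 2 := by
  induction N with
  | zero =>
    have e1 : auxS x 0 = fun _ => 0 := by ext; simp [auxS]
    have e2 : auxT x 0 = fun _ => 0 := by ext; simp [auxT]
    rw [e1, e2]
    refine ⟨MemLp.zero', MemLp.zero', by simp, by simp⟩
  | succ N ih =>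
    obtain ⟨iS, iT, eS, eT⟩ := ih
    have e1 : auxS x (N + 1) = fun ω => auxS x N ω + x (N + 1) ω := by ext; rw [auxS_succ]
    have e2 : auxT x (N + 1) = fun ω => auxT x N ω + x (N + 1) ω * auxS x N ω := by
      ext; rw [auxT_succ]
    have hI : Indep (⨆ j ∈ {j : ℕ | j ≤ N}, MeasurableSpace.comap (x j) inferInstance)
        (⨆ j ∈ ({N + 1} : Set ℕ), MeasurableSpace.comap (x j) inferInstance) P := by
      apply indep_iSup_of_disjoint (fun i => (hm i).comap_le) hind.iIndep
      simp
    have mS := auxS_meas (m := ⨆ j ∈ {j : ℕ | j ≤ N}, MeasurableSpace.comap (x j) inferInstance)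
      x N (fun i hi => meas_iSup x _ i hi)
    have mT := auxT_meas (m := ⨆ j ∈ {j : ℕ | j ≤ N}, MeasurableSpace.comap (x j) inferInstance)
      x N (fun i hi => meas_iSup x _ i hi)
    have mx := meas_iSup x {N + 1} (N + 1) rfl
    have mS0 : Measurable (auxS x N) := auxS_meas x N fun i _ => hm i
    have mT0 : Measurable (auxT x N) := auxT_meas x N fun i _ => hm i
    have iS2 : IndepFun (fun ω => x (N + 1) ω ^ 2) (fun ω => auxS x N ω ^ 2) P :=
      (indep_of_meas hI (mS.pow_const 2) (mx.pow_const 2)).symm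
    have iSx : IndepFun (auxS x N) (x (N + 1)) P := indep_of_meas hI mS mx
    have iTSx : IndepFun (fun ω => auxT x N ω * auxS x N ω) (x (N + 1)) P :=
      indep_of_meas hI (mT.mul mS) mx
    have pL : MemLp (fun ω => x (N + 1) ω * auxS x N ω) 2 P := by
      refine (memLp_two_iff_integrable_sq ((hm _).mul mS0).aestronglyMeasurable).2 ?_
      have := iS2.integrable_mul (h2 (N + 1)).integrable_sq iS.integrable_sq
      refine this.congr (ae_of_all _ fun ω => ?_)
      simp only [Pi.mul_apply]; ring
    have q1 : ∫ ω, auxS x N ω * x (N + 1) ω ∂P = 0 := by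
      rw [iSx.integral_fun_mul_eq_mul_integral iS.1 (h2 _).1, h0, mul_zero]
    have q2 : ∫ ω, (auxT x N ω * auxS x N ω) * x (N + 1) ω ∂P = 0 := by
      rw [iTSx.integral_fun_mul_eq_mul_integral (mT0.mul mS0).aestronglyMeasurable (h2 _).1, h0,
        mul_zero]
    have q3 : ∫ ω, x (N + 1) ω ^ 2 * auxS x N ω ^ 2 ∂P = b2 * (N * b2) := by
      rw [iS2.integral_fun_mul_eq_mul_integral ((hm _).pow_const 2).aestronglyMeasurable
        (mS0.pow_const 2).aestronglyMeasurable, hb, eS]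
    have j1 : Integrable (fun ω => auxS x N ω * x (N + 1) ω) P := iS.integrable_mul (h2 _)
    have j2 : Integrable (fun ω => (auxT x N ω * auxS x N ω) * x (N + 1) ω) P := by
      refine (iT.integrable_mul pL).congr (ae_of_all _ fun ω => ?_)
      simp only [Pi.mul_apply]; ring
    have j3 : Integrable (fun ω => x (N + 1) ω ^ 2 * auxS x N ω ^ 2) P :=
      iS2.integrable_mul (h2 (N + 1)).integrable_sq iS.integrable_sq
    rw [e1, e2]
    refine ⟨iS.add (h2 _), iT.add pL, ?_, ?_⟩
    · have : ∀ ω, (auxS x N ω + x (N + 1) ω) ^ 2 =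
        auxS x N ω ^ 2 + 2 * (auxS x N ω * x (N + 1) ω) + x (N + 1) ω ^ 2 := fun ω => by ring
      simp only [this]
      have j4 : Integrable (fun ω => auxS x N ω ^ 2 + 2 * (auxS x N ω * x (N + 1) ω)) P :=
        iS.integrable_sq.add (j1.const_mul 2)
      rw [integral_add j4 (h2 _).integrable_sq,
        integral_add iS.integrable_sq (j1.const_mul 2), integral_const_mul, q1, eS, hb]
      push_cast; ring
    · have : ∀ ω, (auxT x N ω + x (N + 1) ω * auxS x N ω) ^ 2 =
        auxT x N ω ^ 2 + 2 * ((auxT x N ω * auxS x N ω) * x (N + 1) ω)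
          + x (N + 1) ω ^ 2 * auxS x N ω ^ 2 := fun ω => by ring
      simp only [this]
      have j4 : Integrable (fun ω => auxT x N ω ^ 2 +
          2 * ((auxT x N ω * auxS x N ω) * x (N + 1) ω)) P :=
        iT.integrable_sq.add (j2.const_mul 2)
      rw [integral_add j4 j3,
        integral_add iT.integrable_sq (j2.const_mul 2), integral_const_mul, q2, eT, q3]
      push_cast; ring

lemma meas_random_index {Ω β : Type*} {m : MeasurableSpace Ω} [MeasurableSpace β]
    (f : ℕ → Ω → β) (W : Ω → ℕ)
    (hf : ∀ N, Measurable (f N)) (hW : Measurable W) : Measurable (fun ω => f (W ω) ω) := by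
  have : Measurable (fun p : ℕ × Ω => f p.1 p.2) := measurable_from_prod_countable_right hf
  exact this.comp (hW.prodMk measurable_id)

lemma integrable_random_index {Ω : Type*} {m1 m2 : MeasurableSpace Ω}
    [m0 : MeasurableSpace Ω] (P : Measure Ω) [IsProbabilityMeasure P] (h1 : m1 ≤ m0) (h2 : m2 ≤ m0)
    (hI : Indep m1 m2 P) (f : ℕ → Ω → ℝ) (W : Ω → ℕ) (C : ℝ) (hW : Measurable[m1] W)
    (hf : ∀ N, Measurable[m2] (f N)) (hpos : ∀ N ω, 0 ≤ f N ω) (hint : ∀ N, Integrable (f N) P)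
    (hC : ∀ N, ∫ ω, f N ω ∂P ≤ C * (N : ℝ) ^ 2)
    (hW2 : Integrable (fun ω => (W ω : ℝ) ^ 2) P) :
    Integrable (fun ω => f (W ω) ω) P := by
  have hW0 : Measurable W := hW.mono h1 le_rfl
  have hf0 : ∀ N, Measurable (f N) := fun N => (hf N).mono h2 le_rfl
  refine ⟨(meas_random_index f W hf0 hW0).aestronglyMeasurable, ?_⟩
  rw [hasFiniteIntegral_iff_ofReal (ae_of_all _ fun ω => hpos _ _)]
  have key : ∀ g : ℕ → Ω → ENNReal, ∀ ω,
      g (W ω) ω = ∑' N, (W ⁻¹' {N}).indicator (fun _ => 1) ω * g N ω := by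
    intro g ω
    rw [tsum_eq_single (W ω)]
    · simp
    · intro N hN
      have : ω ∉ W ⁻¹' {N} := fun h => hN h.symm
      simp [this]
  have hmi : ∀ N, Measurable[m1] ((W ⁻¹' {N}).indicator (fun _ => (1 : ENNReal))) := fun N =>
    Measurable.indicator (m := m1) measurable_const (hW (measurableSet_singleton N))
  have hmi0 : ∀ N, Measurable ((W ⁻¹' {N}).indicator (fun _ => (1 : ENNReal))) := fun N =>
    (hmi N).mono h1 le_rfl
  have hfin := (hW2.const_mul C).lintegral_lt_top
  refine lt_of_le_of_lt ?_ hfin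
  have k2 : ∀ g : ℕ → Ω → ENNReal, (∀ N, Measurable (g N)) → ∫⁻ ω, g (W ω) ω ∂P =
      ∑' N, ∫⁻ ω, (W ⁻¹' {N}).indicator (fun _ => 1) ω * g N ω ∂P := by
    intro g hg
    rw [lintegral_congr (key g)]
    exact lintegral_tsum (fun N => ((hmi0 N).mul (hg N)).aemeasurable)
  rw [k2 (fun N ω => ENNReal.ofReal (f N ω)) (fun N => (hf0 N).ennreal_ofReal),
    k2 (fun N ω => ENNReal.ofReal (C * (N : ℝ) ^ 2)) (fun N => measurable_const)]
  refine ENNReal.tsum_le_tsum fun N => ?_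
  rw [lintegral_mul_eq_lintegral_mul_lintegral_of_independent_measurableSpace h1 h2 hI (hmi N)
    ((hf N).ennreal_ofReal), lintegral_mul_const _ (hmi0 N)]
  gcongr
  rw [← ofReal_integral_eq_lintegral_ofReal (hint N) (ae_of_all _ fun ω => hpos _ _)]
  exact ENNReal.ofReal_le_ofReal (hC N)



/-- For `T_k = 2 Σ_{j=2}^{Z_{k−1}} X̃_{k,j} S_{j−1}` one has the conditional second moment
identity `E(T_k² | ℑ(k−1)) = 2 b⁴ Z_{k−1} (Z_{k−1} − 1)` almost surely. -/
theorem conditional_second_moment_of_T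
    {Ω : Type*} [m0 : MeasurableSpace Ω] (P : Measure Ω) [IsProbabilityMeasure P]
    (X : ℕ → ℕ → Ω → ℕ) (ξ : ℕ → Ω → ℕ) (Z : ℕ → Ω → ℕ)
    (b2 : ℝ) (αs βs2 : ℕ → ℝ)
    -- measurability
    (hXm : ∀ n i, Measurable (X n i)) (hξm : ∀ n, Measurable (ξ n))
    -- joint independence of all offspring variables and all immigration variables
    (hindep : iIndepFun (m := fun _ => inferInstance)
      (fun p : (ℕ × ℕ) ⊕ ℕ => Sum.elim (fun q => X q.1 q.2) ξ p) P)
    -- the offspring variables are identically distributed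
    (hid : ∀ n i, IdentDistrib (X n i) (X 1 1) P P)
    -- criticality and finite offspring variance
    (hmean : ∫ ω, (X 1 1 ω : ℝ) ∂P = 1)
    (hb2 : b2 = variance (fun ω => (X 1 1 ω : ℝ)) P)
    (hX2 : MemLp (fun ω => (X 1 1 ω : ℝ)) 2 P)
    -- immigration has finite mean `α_n` and variance `β_n²`
    (hξ2 : ∀ n, MemLp (fun ω => (ξ n ω : ℝ)) 2 P)
    (hα : ∀ n, αs n = ∫ ω, (ξ n ω : ℝ) ∂P)
    (hβ : ∀ n, βs2 n = variance (fun ω => (ξ n ω : ℝ)) P)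
    -- the branching recursion with immigration, started from `Z₀ = 0`
    (hZ0 : ∀ ω, Z 0 ω = 0)
    (hZrec : ∀ n ω, Z (n + 1) ω =
      (∑ i ∈ Finset.range (Z n ω), X (n + 1) (i + 1) ω) + ξ (n + 1) ω)
    -- `ℑ(k)` is the σ-algebra generated by `Z_1, …, Z_k`
    (F : ℕ → MeasurableSpace Ω)
    (hF : ∀ k, F k = ⨆ j ∈ Finset.Icc 1 k, MeasurableSpace.comap (Z j) inferInstance) :
    ∀ k : ℕ, 1 ≤ k →
      P[fun ω => (2 * ∑ j ∈ Finset.Icc 2 (Z (k - 1) ω),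
          ((X k j ω : ℝ) - 1) * (∑ i ∈ Finset.Icc 1 (j - 1), ((X k i ω : ℝ) - 1))) ^ 2
        | F (k - 1)]
        =ᵐ[P] fun ω => 2 * b2 ^ 2 * (Z (k - 1) ω : ℝ) * ((Z (k - 1) ω : ℝ) - 1) := by
  intro k hk
  obtain ⟨n, rfl⟩ : ∃ n, k = n + 1 := ⟨k - 1, by omega⟩
  simp only [Nat.add_sub_cancel]
  set Y : (ℕ × ℕ) ⊕ ℕ → Ω → ℕ := fun p => Sum.elim (fun q => X q.1 q.2) ξ p with hY
  have hYm : ∀ p, Measurable (Y p) := by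
    rintro (q | q)
    · exact hXm _ _
    · exact hξm _
  let A : ℕ → Set ((ℕ × ℕ) ⊕ ℕ) := fun n => {p | Sum.elim (fun q => q.1) id p ≤ n}
  let B : ℕ → Set ((ℕ × ℕ) ⊕ ℕ) := fun n => {p | ∃ i, p = Sum.inl (n + 1, i)}
  let G : Set ((ℕ × ℕ) ⊕ ℕ) → MeasurableSpace Ω := fun A =>
    ⨆ j ∈ A, MeasurableSpace.comap (Y j) inferInstance
  have hGle : ∀ A, G A ≤ m0 := fun A => iSup₂_le fun j _ => (hYm j).comap_le
  have hAB : ∀ n, Indep (G (A n)) (G (B n)) P := by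
    intro n
    apply indep_iSup_of_disjoint (fun i => (hYm i).comap_le) hindep.iIndep
    rw [Set.disjoint_left]
    rintro p hp ⟨i, rfl⟩
    simp [A] at hp
  have hXB : ∀ n i, Measurable[G (B n)] (X (n + 1) i) := fun n i =>
    meas_iSup Y (B n) (Sum.inl (n + 1, i)) ⟨i, rfl⟩
  have hXA : ∀ n m i, m ≤ n → Measurable[G (A n)] (X m i) := fun n m i h =>
    meas_iSup Y (A n) (Sum.inl (m, i)) h
  have hξA : ∀ n m, m ≤ n → Measurable[G (A n)] (ξ m) := fun n m h =>
    meas_iSup Y (A n) (Sum.inr m) h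
  have hGmono : ∀ m n, m ≤ n → G (A m) ≤ G (A n) := fun m n h =>
    biSup_mono fun p (hp : _ ≤ m) => le_trans hp h
  have hZA : ∀ n, Measurable[G (A n)] (Z n) := by
    intro n
    induction n with
    | zero =>
      have : Z 0 = fun _ => 0 := funext hZ0
      rw [this]; exact measurable_const
    | succ n ih =>
      have : Z (n + 1) = fun ω => (∑ i ∈ Finset.range (Z n ω), X (n + 1) (i + 1) ω) + ξ (n + 1) ω :=
        funext (hZrec n)
      rw [this]
      refine Measurable.add ?_ (hξA _ _ le_rfl)
      refine meas_random_index (m := G (A (n + 1)))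
        (fun N ω => ∑ i ∈ Finset.range N, X (n + 1) (i + 1) ω) (Z n) (fun N => ?_)
        (ih.mono (hGmono _ _ (Nat.le_succ n)) le_rfl)
      exact Finset.measurable_fun_sum _ fun i _ => hXA _ _ _ le_rfl
  have hcast : Measurable (fun n : ℕ => (n : ℝ)) := measurable_from_top
  have hidR : ∀ n i, IdentDistrib (fun ω => (X n i ω : ℝ)) (fun ω => (X 1 1 ω : ℝ)) P P :=
    fun n i => (hid n i).comp hcast
  have hXL : ∀ n i, MemLp (fun ω => (X n i ω : ℝ)) 2 P := fun n i =>
    (hidR n i).memLp_iff.2 hX2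
  have hZL : ∀ n, Integrable (fun ω => (Z n ω : ℝ) ^ 2) P := by
    intro n
    induction n with
    | zero => simp [hZ0]
    | succ n ih =>
      let f : ℕ → Ω → ℝ := fun N ω => (∑ i ∈ Finset.range N, (X (n + 1) (i + 1) ω : ℝ)) ^ 2
      have hfL : ∀ N, Integrable (f N) P := fun N =>
        (memLp_finsetSum (Finset.range N) (fun i _ => hXL (n + 1) (i + 1))).integrable_sq
      have hI : Integrable (fun ω => f (Z n ω) ω) P := by
        refine integrable_random_index P (hGle _) (hGle _) (hAB n) f (Z n)
          (∫ ω, (X 1 1 ω : ℝ) ^ 2 ∂P) (hZA n) (fun N => ?_) (fun N ω => sq_nonneg _) hfL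
          (fun N => ?_) ih
        · exact (Finset.measurable_fun_sum _ fun i _ => hcast.comp (hXB n (i + 1))).pow_const 2
        · calc ∫ ω, f N ω ∂P
              ≤ ∫ ω, (N : ℝ) * ∑ i ∈ Finset.range N, (X (n + 1) (i + 1) ω : ℝ) ^ 2 ∂P := by
                refine integral_mono (hfL N) ?_ fun ω => ?_
                · exact (integrable_finsetSum _ fun i _ => (hXL _ _).integrable_sq).const_mul _
                · simpa using sq_sum_le_card_mul_sum_sq (s := Finset.range N)
                    (f := fun i => (X (n + 1) (i + 1) ω : ℝ))
            _ = (∫ ω, (X 1 1 ω : ℝ) ^ 2 ∂P) * (N : ℝ) ^ 2 := by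
                rw [integral_const_mul, integral_finsetSum _ fun i _ => (hXL _ _).integrable_sq]
                have : ∀ i, ∫ ω, (X (n + 1) (i + 1) ω : ℝ) ^ 2 ∂P = ∫ ω, (X 1 1 ω : ℝ) ^ 2 ∂P :=
                  fun i => ((hidR (n + 1) (i + 1)).comp (measurable_id.pow_const 2)).integral_eq
                simp only [this, Finset.sum_const, Finset.card_range, nsmul_eq_mul]
                ring
      refine ((hI.add (hξ2 (n + 1)).integrable_sq).const_mul 2).mono'
        ((hcast.comp ((hZA _).mono (hGle _) le_rfl)).pow_const 2).aestronglyMeasurable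
        (ae_of_all _ fun ω => ?_)
      rw [Real.norm_of_nonneg (sq_nonneg _), hZrec]
      simp only [f, Pi.add_apply]
      push_cast
      exact add_sq_le
  -- the centred row
  let x : ℕ → Ω → ℝ := fun i ω => (X (n + 1) i ω : ℝ) - 1
  have hcast1 : Measurable (fun n : ℕ => (n : ℝ) - 1) := measurable_from_top
  have hxB : ∀ i, Measurable[G (B n)] (x i) := fun i => hcast1.comp (hXB n i)
  have hxm : ∀ i, Measurable (x i) := fun i => (hxB i).mono (hGle _) le_rfl
  have hxind : iIndepFun x P := by
    have h1 : iIndepFun (fun i => Y (Sum.inl (n + 1, i))) P :=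
      hindep.precomp (g := fun i : ℕ => (Sum.inl (n + 1, i) : (ℕ × ℕ) ⊕ ℕ))
        (fun a b h => by simpa using h)
    exact h1.comp (fun _ (k : ℕ) => (k : ℝ) - 1) (fun _ => hcast1)
  have hx2 : ∀ i, MemLp (x i) 2 P := fun i => (hXL _ _).sub (memLp_const 1)
  have hx0 : ∀ i, ∫ ω, x i ω ∂P = 0 := by
    intro i
    simp only [x]
    rw [integral_sub ((hXL _ _).integrable (by norm_num)) (integrable_const _),
      (hidR _ _).integral_eq, hmean]
    simp
  have hxb : ∀ i, ∫ ω, x i ω ^ 2 ∂P = b2 := by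
    intro i
    rw [hb2, variance_eq_integral hX2.1.aemeasurable, hmean]
    exact ((hid (n + 1) i).comp (hcast1.pow_const 2)).integral_eq
  have hmom := moments P x b2 hxm hxind hx2 hx0 hxb
  let f : ℕ → Ω → ℝ := fun N ω => (2 * auxT x N ω) ^ 2
  have hfB : ∀ N, Measurable[G (B n)] (f N) := fun N =>
    ((auxT_meas (m := G (B n)) x N fun i _ => hxB i).const_mul 2).pow_const 2
  have hfL : ∀ N, Integrable (f N) P := fun N => ((hmom N).2.1.const_mul 2).integrable_sq
  have hfE : ∀ N : ℕ, ∫ ω, f N ω ∂P = 2 * b2 ^ 2 * N * (N - 1) := by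
    intro N
    simp only [f, mul_pow]
    rw [integral_const_mul, (hmom N).2.2.2]
    ring
  have hTint : Integrable (fun ω => f (Z n ω) ω) P := by
    refine integrable_random_index P (hGle _) (hGle _) (hAB n) f (Z n) (2 * b2 ^ 2) (hZA n) hfB
      (fun N ω => sq_nonneg _) hfL (fun N => ?_) (hZL n)
    rw [hfE]
    have : 0 ≤ b2 ^ 2 * (N : ℝ) := by positivity
    nlinarith
  have hFA : F n ≤ G (A n) := by
    rw [hF]
    refine iSup₂_le fun j hj => ?_
    exact ((hZA j).mono (hGmono _ _ (Finset.mem_Icc.1 hj).2) le_rfl).comap_le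
  have hFle : F n ≤ m0 := hFA.trans (hGle _)
  have hZF : Measurable[F n] (Z n) := by
    rcases Nat.eq_zero_or_pos n with rfl | hn
    · have : Z 0 = fun _ => 0 := funext hZ0
      rw [this]; exact measurable_const
    · apply Measurable.of_comap_le
      rw [hF]
      exact le_biSup (fun j => MeasurableSpace.comap (Z j) inferInstance)
        (Finset.mem_Icc.2 ⟨hn, le_rfl⟩)
  change P[fun ω => f (Z n ω) ω | F n] =ᵐ[P] _
  have hall : ∀ᵐ ω ∂P, ∀ N : ℕ, (Z n ⁻¹' {N}).indicator (P[fun ω => f (Z n ω) ω | F n]) ω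
      = (Z n ⁻¹' {N}).indicator (fun _ => 2 * b2 ^ 2 * (N : ℝ) * (N - 1)) ω := by
    rw [ae_all_iff]
    intro N
    have hs : MeasurableSet[F n] (Z n ⁻¹' {N}) := hZF (measurableSet_singleton N)
    have e : (Z n ⁻¹' {N}).indicator (fun ω => f (Z n ω) ω) = (Z n ⁻¹' {N}).indicator (f N) := by
      ext ω
      by_cases h : Z n ω = N
      · simp [h]
      · simp [h]
    have a1 := condExp_indicator hTint hs
    have a2 := condExp_indicator (hfL N) hs
    have a3 := condExp_indep_eq (hGle (B n)) hFle (hfB N).stronglyMeasurable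
      (indep_of_indep_of_le_right (hAB n).symm hFA)
    rw [e] at a1
    filter_upwards [a1, a2, a3] with ω h1 h2 h3
    rw [← h1, h2]
    simp only [Set.indicator, h3, hfE]
  filter_upwards [hall] with ω hω
  simpa using hω (Z n ω)
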